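/- arXiv:1702.06290 — 2 statements merged into one kernel-verified Lean document; each statement's English description precedes it below -/
import Mathlib

section
/- The assignment t ↦ σ_1 t σ_1 and σ_i ↦ σ_{i+1} (1 ≤ i ≤ n−1) extends to a group homomorphism sh : B_{1,n} → B_{1,n+1}, and sh induces an R-algebra homomorphism Φ : H_{1,n}(q) → H_{1,n+1}(q) with Φ(g_i) = g_{i+1} and Φ(t) = g_1 t g_1. Consequently, for every p ∈ ℤ, every α ∈ B_{1,n}, and every expression π(α) = Σ_i f_i π(w_i) with f_i ∈ R and w_i ∈ B_{1,n}, one has π(t^p · sh(α) · σ_1^{±1}) = Σ_i f_i · t^p · Φ(π(w_i)) · g_1^{±1} in H_{1,n+1}(q); that is, braid band moves are interchangeable with the quadratic (skein) relation. -/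
set_option synthInstance.maxHeartbeats 1000000
set_option maxHeartbeats 2000000

namespace MB

/-! ## The mixed braid group `B_{1,n}` (with `m = n - 1` braiding generators) -/

/-- Generators: `none` is the looping generator `t`, `some i` is `σ_{i+1}` for `i : Fin m`. -/
abbrev MBGen (m : ℕ) := Option (Fin m)

/-- The relators of the mixed braid group `B_{1,n}` (`m = n-1`):
`σ₁tσ₁t = tσ₁tσ₁`; `tσ_i = σ_i t` for `i > 1`; the braid relations among the `σ_i`. -/
def rels (m : ℕ) : Set (FreeGroup (MBGen m)) :=
  { r | (∃ h : 0 < m,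
          r = (FreeGroup.of (some ⟨0, h⟩) * FreeGroup.of none) ^ 2 *
              ((FreeGroup.of (none : MBGen m) * FreeGroup.of (some ⟨0, h⟩)) ^ 2)⁻¹) ∨
        (∃ i : Fin m, 1 ≤ (i : ℕ) ∧
          r = FreeGroup.of (none : MBGen m) * FreeGroup.of (some i) *
              (FreeGroup.of (some i) * FreeGroup.of (none : MBGen m))⁻¹) ∨
        (∃ i j : Fin m, (i : ℕ) + 1 = (j : ℕ) ∧
          r = FreeGroup.of (some i) * FreeGroup.of (some j) * FreeGroup.of (some i) *
              (FreeGroup.of (some j) * FreeGroup.of (some i) * FreeGroup.of (some j))⁻¹) ∨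
        (∃ i j : Fin m, (i : ℕ) + 1 < (j : ℕ) ∧
          r = FreeGroup.of (some i) * FreeGroup.of (some j) *
              (FreeGroup.of (some j) * FreeGroup.of (some i))⁻¹) }

/-- The mixed braid group `B_{1,n}` with `n = m+1` moving strands. -/
abbrev B (m : ℕ) := PresentedGroup (rels m)

/-- The braiding generator `σ_{i+1}`, for `i : Fin m`. -/
def σ {m : ℕ} (i : Fin m) : B m := PresentedGroup.of (some i)

/-- The looping generator `t`. -/
def τ {m : ℕ} : B m := PresentedGroup.of none

/-- `σ_j` in one-based indexing (`1 ≤ j ≤ m`), junk value `1` out of range. -/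
def sig {m : ℕ} (j : ℕ) : B m :=
  if h : 1 ≤ j ∧ j - 1 < m then σ ⟨j - 1, h.2⟩ else 1

/-- The looping elements `t_i = σ_i ⋯ σ_1 t σ_1 ⋯ σ_i` (for `0 ≤ i ≤ m`), via `t_0 = t`,
`t_{j+1} = σ_{j+1} t_j σ_{j+1}`. -/
def tt {m : ℕ} : ℕ → B m
  | 0 => τ
  | (j+1) => sig (j+1) * tt j * sig (j+1)

/-- The looping elements `t′_i = σ_i ⋯ σ_1 t σ_1⁻¹ ⋯ σ_i⁻¹` (for `0 ≤ i ≤ m`), via `t′_0 = t`,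
`t′_{j+1} = σ_{j+1} t′_j σ_{j+1}⁻¹`. -/
def tp {m : ℕ} : ℕ → B m
  | 0 => τ
  | (j+1) => sig (j+1) * tp j * (sig (j+1))⁻¹

/-! ## The generalized Iwahori–Hecke algebra of type B, `H_{1,n}(q)` -/

/-- The ground ring `R = ℂ[q^{±1}]` of Laurent polynomials. -/
abbrev R : Type := LaurentPolynomial ℂ

instance : IsDomain R := NoZeroDivisors.to_isDomain _

/-- The variable `q ∈ R`. -/
noncomputable def qq : R := LaurentPolynomial.T 1

/-- The quadratic Hecke relations `σ_i² = (q-1)σ_i + q`. -/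
inductive heckeRel (m : ℕ) :
    MonoidAlgebra R (B m) → MonoidAlgebra R (B m) → Prop
  | quad (i : Fin m) : heckeRel m
      (MonoidAlgebra.of R (B m) (σ i) * MonoidAlgebra.of R (B m) (σ i))
      ((qq - 1) • MonoidAlgebra.of R (B m) (σ i) + qq • (1 : MonoidAlgebra R (B m)))

/-- The generalized Iwahori–Hecke algebra of type B, `H_{1,n}(q)` (`n = m+1`), as the quotient
of the group algebra `R[B_{1,n}]` by the two-sided ideal generated by the quadratic relations. -/
abbrev H (m : ℕ) := RingQuot (heckeRel m)

/-- The canonical multiplicative map `π : B_{1,n} → H_{1,n}(q)`. -/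
noncomputable def pih (m : ℕ) : B m →* H m :=
  (RingQuot.mkRingHom (heckeRel m)).toMonoidHom.comp (MonoidAlgebra.of R (B m))

/-- The subalgebra `H_n(q)` of `H_{1,n}(q)` generated by the images `g_1, …, g_{n-1}`
of `σ_1, …, σ_{n-1}`. -/
noncomputable def HA (m : ℕ) : Subalgebra R (H m) :=
  Algebra.adjoin R (Set.range fun i : Fin m => pih m (σ i))

theorem aux_comm {G : Type*} [Group G] (a b t : G) (h1 : a * t * a * t = t * a * t * a)
    (h2 : t * b = b * t) (h3 : a * b * a = b * a * b) :
    (b * (a * t * a)) ^ 2 = ((a * t * a) * b) ^ 2 := by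
  calc (b * (a * t * a)) ^ 2 = b * a * t * (a * b * a) * t * a := by simp only [pow_two, mul_assoc]
    _ = b * a * (t * b) * a * b * t * a := by rw [h3]; simp only [mul_assoc]
    _ = b * a * b * t * a * (b * t) * a := by rw [h2]; simp only [mul_assoc]
    _ = (b * a * b) * t * a * t * b * a := by rw [← h2]; simp only [mul_assoc]
    _ = a * b * (a * t * a * t) * b * a := by rw [← h3]; simp only [mul_assoc]
    _ = a * b * t * a * t * (a * b * a) := by rw [h1]; simp only [mul_assoc]
    _ = a * (b * t) * a * (t * b) * a * b := by rw [h3]; simp only [mul_assoc]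
    _ = a * t * (b * a * b) * t * a * b := by rw [← h2]; nth_rw 2 [h2]; simp only [mul_assoc]
    _ = ((a * t * a) * b) ^ 2 := by rw [← h3]; simp only [pow_two, mul_assoc]

theorem rel_t (m : ℕ) : (σ 0 * τ * σ 0 * τ : B (m+1)) = τ * σ 0 * τ * σ 0 := by
  have h : (PresentedGroup.mk (rels (m+1))) _ = 1 :=
    PresentedGroup.one_of_mem (rels := rels (m+1)) (Or.inl ⟨Nat.succ_pos m, rfl⟩)
  rw [map_mul, map_inv, mul_inv_eq_one] at h
  have h' : (σ 0 * τ : B (m+1)) ^ 2 = (τ * σ 0) ^ 2 := by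
    simp only [map_pow, map_mul] at h
    exact h
  simpa only [pow_two, mul_assoc] using h'

theorem rel_c {m : ℕ} (i : Fin m) (hi : 1 ≤ (i : ℕ)) : (τ * σ i : B m) = σ i * τ := by
  have h : (PresentedGroup.mk (rels m)) _ = 1 :=
    PresentedGroup.one_of_mem (rels := rels m) (Or.inr (Or.inl ⟨i, hi, rfl⟩))
  rw [map_mul, map_inv, mul_inv_eq_one] at h
  have h' : (τ * σ i : B m) = σ i * τ := by
    simp only [map_mul] at h
    exact h
  exact h'

theorem rel_b {m : ℕ} (i j : Fin m) (hi : (i : ℕ) + 1 = j) :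
    (σ i * σ j * σ i : B m) = σ j * σ i * σ j := by
  have h : (PresentedGroup.mk (rels m)) _ = 1 :=
    PresentedGroup.one_of_mem (rels := rels m) (Or.inr (Or.inr (Or.inl ⟨i, j, hi, rfl⟩)))
  rw [map_mul, map_inv, mul_inv_eq_one] at h
  have h' : (σ i * σ j * σ i : B m) = σ j * σ i * σ j := by
    simp only [map_mul] at h
    exact h
  exact h'

theorem rel_f {m : ℕ} (i j : Fin m) (hi : (i : ℕ) + 1 < j) :
    (σ i * σ j : B m) = σ j * σ i := by
  have h : (PresentedGroup.mk (rels m)) _ = 1 :=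
    PresentedGroup.one_of_mem (rels := rels m) (Or.inr (Or.inr (Or.inr ⟨i, j, hi, rfl⟩)))
  rw [map_mul, map_inv, mul_inv_eq_one] at h
  have h' : (σ i * σ j : B m) = σ j * σ i := by
    simp only [map_mul] at h
    exact h
  exact h'

def shf (m : ℕ) : MBGen m → B (m+1)
  | none => σ 0 * τ * σ 0
  | some i => σ i.succ

theorem shf_rels (m : ℕ) : ∀ r ∈ rels m, FreeGroup.lift (shf m) r = 1 := by
  rintro r (⟨h, rfl⟩ | ⟨i, hi, rfl⟩ | ⟨i, j, hij, rfl⟩ | ⟨i, j, hij, rfl⟩) <;>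
    rw [map_mul, map_inv, mul_inv_eq_one] <;>
    simp only [map_mul, map_pow, FreeGroup.lift_apply_of, shf]
  · exact aux_comm _ _ _ (rel_t m) (rel_c _ (by simp)) (rel_b _ _ (by simp))
  · have hc : Commute (σ 0 : B (m+1)) (σ i.succ) := rel_f _ _ (by simpa using by omega)
    have ht : Commute (τ : B (m+1)) (σ i.succ) := rel_c _ (by simp)
    exact (hc.mul_left ht).mul_left hc
  · exact rel_b _ _ (by simpa using hij)
  · exact rel_f _ _ (by simpa using hij)

def shh (m : ℕ) : B m →* B (m+1) := PresentedGroup.toGroup (shf_rels m)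

theorem pih_eq (m : ℕ) (x : B m) :
    pih m x = RingQuot.mkAlgHom R (heckeRel m) (MonoidAlgebra.of R (B m) x) := by
  rw [← AlgHom.coe_toRingHom, RingQuot.mkAlgHom_coe]
  rfl

theorem pih_quad (m : ℕ) (i : Fin m) :
    pih m (σ i) * pih m (σ i) = (qq - 1) • pih m (σ i) + qq • (1 : H m) := by
  have h := RingQuot.mkAlgHom_rel R (heckeRel.quad i)
  rw [map_mul, map_add, map_smul, map_smul, map_one, ← pih_eq] at h
  exact h

theorem lift_rel (m : ℕ) ⦃x y : MonoidAlgebra R (B m)⦄ (h : heckeRel m x y) :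
    MonoidAlgebra.lift R (H (m+1)) (B m) ((pih (m+1)).comp (shh m)) x =
      MonoidAlgebra.lift R (H (m+1)) (B m) ((pih (m+1)).comp (shh m)) y := by
  cases h with
  | quad i =>
    have e : shh m (σ i) = σ i.succ := PresentedGroup.toGroup.of (shf_rels m)
    rw [map_mul, map_add, map_smul, map_smul, map_one, MonoidAlgebra.lift_of,
      MonoidHom.comp_apply, e]
    exact pih_quad _ _

noncomputable def Phi (m : ℕ) : H m →ₐ[R] H (m+1) :=
  RingQuot.liftAlgHom R ⟨MonoidAlgebra.lift R (H (m+1)) (B m) ((pih (m+1)).comp (shh m)), lift_rel m⟩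

theorem Phi_pih (m : ℕ) (x : B m) : Phi m (pih m x) = pih (m+1) (shh m x) := by
  rw [pih_eq, Phi, RingQuot.liftAlgHom_mkAlgHom_apply, MonoidAlgebra.lift_of]
  rfl

/-- The assignment `t ↦ σ₁tσ₁`, `σ_i ↦ σ_{i+1}` extends to a group
homomorphism `sh : B_{1,n} → B_{1,n+1}`, which induces an `R`-algebra homomorphism
`Φ : H_{1,n}(q) → H_{1,n+1}(q)` with `Φ(g_i) = g_{i+1}`, `Φ(t) = g₁tg₁`; consequently braid
band moves are interchangeable with the quadratic (skein) relation. -/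
theorem shift_hom_and_skein (m : ℕ) :
    ∃ sh : B m →* B (m+1),
      sh τ = σ 0 * τ * σ 0 ∧ (∀ i : Fin m, sh (σ i) = σ i.succ) ∧
      ∃ Φ : H m →ₐ[R] H (m+1),
        (∀ i : Fin m, Φ (pih m (σ i)) = pih (m+1) (σ i.succ)) ∧
        Φ (pih m τ) = pih (m+1) (σ 0) * pih (m+1) τ * pih (m+1) (σ 0) ∧
        (∀ x : B m, Φ (pih m x) = pih (m+1) (sh x)) ∧
        ∀ (p ε : ℤ), ε = 1 ∨ ε = -1 →
          ∀ (α : B m) (N : ℕ) (f : Fin N → R) (w : Fin N → B m),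
            pih m α = ∑ i, f i • pih m (w i) →
            pih (m+1) (τ ^ p * sh α * σ 0 ^ ε) =
              ∑ i, f i •
                (pih (m+1) (τ ^ p) * Φ (pih m (w i)) * pih (m+1) (σ 0 ^ ε)) := by
  have e : ∀ i : Fin m, shh m (σ i) = σ i.succ := fun i => PresentedGroup.toGroup.of (shf_rels m)
  have et : shh m τ = σ 0 * τ * σ 0 := PresentedGroup.toGroup.of (shf_rels m)
  refine ⟨shh m, et, e, Phi m, fun i => by rw [Phi_pih, e], by rw [Phi_pih, et, map_mul, map_mul],
    Phi_pih m, ?_⟩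
  intro p ε _ α N f w h
  rw [map_mul, map_mul, ← Phi_pih, h, map_sum, Finset.mul_sum, Finset.sum_mul]
  refine Finset.sum_congr rfl fun i _ => ?_
  rw [map_smul, mul_smul_comm, smul_mul_assoc]

end MB
end

section
/- Every element of B_{1,n} can be written as τ′ · w, where τ′ lies in the subgroup of B_{1,n} generated by the looping elements t′_0, t′_1, …, t′_{n−1} and w lies in the subgroup generated by σ_1, …, σ_{n−1}; moreover the subgroup generated by t′_0, t′_1, …, t′_{n−1} is a free group of rank n (Artin combing for mixed braids). -/
set_option synthInstance.maxHeartbeats 1000000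
set_option maxHeartbeats 2000000

namespace MB

/-! ### The Artin action on the free group on `ℕ` -/

/-- Artin endomorphism. -/
def artFun (j : ℕ) : FreeGroup ℕ →* FreeGroup ℕ :=
  FreeGroup.lift (fun k => if k = j then FreeGroup.of (j+1) else
    if k = j + 1 then (FreeGroup.of (j+1))⁻¹ * FreeGroup.of j * FreeGroup.of (j+1)
    else FreeGroup.of k)

/-- Inverse Artin endomorphism. -/
def artInv (j : ℕ) : FreeGroup ℕ →* FreeGroup ℕ :=
  FreeGroup.lift (fun k => if k = j + 1 then FreeGroup.of j else
    if k = j then FreeGroup.of j * FreeGroup.of (j+1) * (FreeGroup.of j)⁻¹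
    else FreeGroup.of k)

lemma artFun_self (j : ℕ) : artFun j (FreeGroup.of j) = FreeGroup.of (j+1) := by
  simp [artFun]

lemma artFun_succ (j : ℕ) : artFun j (FreeGroup.of (j+1)) =
    (FreeGroup.of (j+1))⁻¹ * FreeGroup.of j * FreeGroup.of (j+1) := by
  simp [artFun]

lemma artFun_ne (j k : ℕ) (h : k ≠ j) (h' : k ≠ j + 1) :
    artFun j (FreeGroup.of k) = FreeGroup.of k := by
  simp [artFun, h, h']

lemma artInv_self (j : ℕ) : artInv j (FreeGroup.of j) =
    FreeGroup.of j * FreeGroup.of (j+1) * (FreeGroup.of j)⁻¹ := by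
  simp [artInv]

lemma artInv_succ (j : ℕ) : artInv j (FreeGroup.of (j+1)) = FreeGroup.of j := by
  simp [artInv]

lemma artInv_ne (j k : ℕ) (h : k ≠ j) (h' : k ≠ j + 1) :
    artInv j (FreeGroup.of k) = FreeGroup.of k := by
  simp [artInv, h, h']

/-- Artin automorphism. -/
def art (j : ℕ) : MulAut (FreeGroup ℕ) :=
  MonoidHom.toMulEquiv (artFun j) (artInv j)
    (by
      ext k
      by_cases h : k = j
      · subst h
        simp [artFun_self, artInv_succ]
      by_cases h' : k = j + 1
      · subst h'
        simp [artFun_succ, artInv_succ, artInv_self, mul_assoc]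
      · simp [artFun_ne j k h h', artInv_ne j k h h'])
    (by
      ext k
      by_cases h : k = j
      · subst h
        simp [artFun_self, artFun_succ, artInv_self, mul_assoc]
      by_cases h' : k = j + 1
      · subst h'
        simp [artInv_succ, artFun_self]
      · simp [artFun_ne j k h h', artInv_ne j k h h'])

lemma art_apply (j : ℕ) (x : FreeGroup ℕ) : art j x = artFun j x := rfl

lemma mulAut_ext {f g : MulAut (FreeGroup ℕ)}
    (h : ∀ k, f (FreeGroup.of k) = g (FreeGroup.of k)) : f = g := by
  apply MulEquiv.toMonoidHom_injective
  ext k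
  exact h k

lemma art_far (i j : ℕ) (h : i + 1 < j) : art i * art j = art j * art i := by
  apply mulAut_ext
  intro k
  simp only [MulAut.mul_apply, art_apply]
  by_cases h1 : k = i
  · subst h1
    rw [artFun_ne j k (by omega) (by omega), artFun_self, artFun_ne j (k+1) (by omega) (by omega)]
  by_cases h2 : k = i + 1
  · subst h2
    rw [artFun_ne j (i+1) (by omega) (by omega), artFun_succ]
    simp only [map_mul, map_inv]
    rw [artFun_ne j (i+1) (by omega) (by omega), artFun_ne j i (by omega) (by omega)]
  by_cases h3 : k = j
  · subst h3
    rw [artFun_ne i k (by omega) (by omega), artFun_self, artFun_ne i (k+1) (by omega) (by omega)]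
  by_cases h4 : k = j + 1
  · subst h4
    rw [artFun_ne i (j+1) (by omega) (by omega), artFun_succ]
    simp only [map_mul, map_inv]
    rw [artFun_ne i (j+1) (by omega) (by omega), artFun_ne i j (by omega) (by omega)]
  rw [artFun_ne i k h1 h2, artFun_ne j k h3 h4, artFun_ne i k h1 h2]

lemma art_braid (i : ℕ) : art i * art (i+1) * art i = art (i+1) * art i * art (i+1) := by
  apply mulAut_ext
  intro k
  simp only [MulAut.mul_apply, art_apply]
  have e1 := artFun_ne (i+1) i (by omega) (by omega)
  have e2 := artFun_ne i (i+1+1) (by omega) (by omega)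
  have e3 := artFun_self i
  have e4 := artFun_succ i
  have e5 := artFun_self (i+1)
  have e6 := artFun_succ (i+1)
  by_cases h1 : k = i
  · subst h1
    simp [e1, e2, e3, e4, e5, e6, mul_assoc]
  by_cases h2 : k = i + 1
  · subst h2
    simp [e1, e2, e3, e4, e5, e6, mul_assoc]
  by_cases h3 : k = i + 1 + 1
  · subst h3
    simp [e1, e2, e3, e4, e5, e6, mul_assoc]
  rw [artFun_ne i k h1 h2, artFun_ne (i+1) k h2 h3, artFun_ne i k h1 h2, artFun_ne (i+1) k h2 h3]

/-- The holomorph of the free group. -/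
abbrev Hol := FreeGroup ℕ ⋊[MonoidHom.id (MulAut (FreeGroup ℕ))] MulAut (FreeGroup ℕ)

/-- Images of the generators in the holomorph. -/
def genMap (m : ℕ) : MBGen m → Hol
  | none => SemidirectProduct.inl (FreeGroup.of 0)
  | some i => SemidirectProduct.inr (art i)

lemma genMap_rels (m : ℕ) : ∀ r ∈ rels m, FreeGroup.lift (genMap m) r = 1 := by
  rintro r (⟨h, rfl⟩ | ⟨i, hi, rfl⟩ | ⟨i, j, hij, rfl⟩ | ⟨i, j, hij, rfl⟩)
  · rw [map_mul, map_inv, mul_inv_eq_one]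
    simp only [map_pow, map_mul, FreeGroup.lift_apply_of, genMap]
    apply SemidirectProduct.ext
    · have e1 := artFun_self 0
      have e2 := artFun_succ 0
      simp only [zero_add] at e1 e2
      simp [pow_two, art_apply, e1, e2, mul_assoc]
    · simp [pow_two]
  · rw [map_mul, map_inv, mul_inv_eq_one]
    simp only [map_mul, FreeGroup.lift_apply_of, genMap]
    apply SemidirectProduct.ext
    · simp [art_apply, artFun_ne (i : ℕ) 0 (by omega) (by omega)]
    · simp
  · rw [map_mul, map_inv, mul_inv_eq_one]
    simp only [map_mul, FreeGroup.lift_apply_of, genMap]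
    rw [← hij]
    simp only [← map_mul, art_braid]
  · rw [map_mul, map_inv, mul_inv_eq_one]
    simp only [map_mul, FreeGroup.lift_apply_of, genMap]
    simp only [← map_mul, art_far _ _ hij]

/-- The representation of `B m` in the holomorph. -/
def rep (m : ℕ) : B m →* Hol := PresentedGroup.toGroup (genMap_rels m)

lemma rep_tau (m : ℕ) : rep m τ = SemidirectProduct.inl (FreeGroup.of 0) :=
  PresentedGroup.toGroup.of (genMap_rels m)

lemma sig_succ {m : ℕ} (j : ℕ) (h : j < m) : (sig (j+1) : B m) = σ ⟨j, h⟩ := by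
  simp [sig, h]

lemma rep_sig (m j : ℕ) (h : j < m) :
    rep m (sig (j+1)) = SemidirectProduct.inr (art j) := by
  rw [sig_succ j h]
  exact PresentedGroup.toGroup.of (genMap_rels m)

lemma rep_tp (m j : ℕ) (h : j ≤ m) :
    rep m (tp j) = SemidirectProduct.inl (FreeGroup.of j) := by
  induction j with
  | zero => exact rep_tau m
  | succ j ih =>
    simp only [tp, map_mul, map_inv]
    rw [ih (by omega), rep_sig m j (by omega), ← map_inv, ← SemidirectProduct.inl_aut]
    simp [art_apply, artFun_self]

/-! ### Relations in `B m` -/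

lemma rel_one {m : ℕ} {x y : FreeGroup (MBGen m)} (h : x * y⁻¹ ∈ rels m) :
    (PresentedGroup.mk (rels m) x) = PresentedGroup.mk (rels m) y := by
  have := PresentedGroup.one_of_mem h
  rwa [map_mul, map_inv, mul_inv_eq_one] at this

lemma sig_tau0 {m : ℕ} (h : 0 < m) :
    ((sig 1 : B m) * τ) ^ 2 = (τ * sig 1) ^ 2 := by
  have := sig_succ (m := m) 0 h
  rw [zero_add] at this
  rw [this]
  exact rel_one (m := m) (Or.inl ⟨h, rfl⟩)

lemma sig_tau {m j : ℕ} (h : j < m) (hj : 1 ≤ j) :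
    Commute (sig (j+1) : B m) τ := by
  rw [sig_succ j h]
  exact (rel_one (m := m) (Or.inr (Or.inl ⟨⟨j, h⟩, hj, rfl⟩))).symm

lemma sig_braid {m j : ℕ} (h : j + 1 < m) :
    (sig (j+1) : B m) * sig (j+1+1) * sig (j+1) = sig (j+1+1) * sig (j+1) * sig (j+1+1) := by
  rw [sig_succ j (by omega), sig_succ (j+1) h]
  exact rel_one (m := m) (Or.inr (Or.inr (Or.inl ⟨⟨j, by omega⟩, ⟨j+1, h⟩, rfl, rfl⟩)))

lemma sig_far {m i j : ℕ} (hij : i + 1 < j) (h : j < m) :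
    Commute (sig (i+1) : B m) (sig (j+1)) := by
  rw [sig_succ i (by omega), sig_succ j h]
  exact rel_one (m := m) (Or.inr (Or.inr (Or.inr ⟨⟨i, by omega⟩, ⟨j, h⟩, hij, rfl⟩)))

lemma comm_low {m j : ℕ} (h : j < m) (k : ℕ) (hk : k < j) :
    Commute (sig (j+1) : B m) (tp k) := by
  induction k with
  | zero => exact sig_tau h (by omega)
  | succ k ih =>
    have c := (sig_far (m := m) (i := k) (j := j) (by omega) h).symm
    exact (c.mul_right (ih (by omega))).mul_right c.inv_right

lemma conj_self {m : ℕ} (j : ℕ) :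
    (sig (j+1) : B m) * tp j * (sig (j+1))⁻¹ = tp (j+1) := rfl

lemma comm_high {m j : ℕ} (d : ℕ) (h : j + 2 + d ≤ m) :
    Commute (sig (j+1) : B m) (tp (j+2+d)) := by
  induction d with
  | zero =>
    have b := sig_braid (m := m) (j := j) (by omega)
    have c := comm_low (m := m) (j := j+1) (by omega) j (by omega)
    show _ * tp (j+1+1) = tp (j+1+1) * _
    rw [← conj_self (j+1), ← conj_self j]
    generalize (sig (j+1) : B m) = x at *
    generalize (sig (j+1+1) : B m) = y at *
    generalize (tp j : B m) = t at *
    have c' : y * t = t * y := c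
    have b2 : x⁻¹ * y⁻¹ * x = y * x⁻¹ * y⁻¹ := by
      have : x = (y * x) * y * (y * x)⁻¹ := by
        rw [← b]
        group
      calc x⁻¹ * y⁻¹ * x = x⁻¹ * y⁻¹ * ((y * x) * y * (y * x)⁻¹) := by rw [← this]
        _ = _ := by group
    calc x * (y * (x * t * x⁻¹) * y⁻¹) = (x * y * x) * t * x⁻¹ * y⁻¹ := by group
      _ = y * x * (y * t) * x⁻¹ * y⁻¹ := by rw [b]; group
      _ = y * x * t * (y * x⁻¹ * y⁻¹) := by rw [c']; group
      _ = _ := by rw [← b2]; group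
  | succ d ih =>
    have c := sig_far (m := m) (i := j) (j := j+2+d) (by omega) (by omega)
    exact (c.mul_right (ih (by omega))).mul_right c.inv_right

lemma conj_succ {m : ℕ} (j : ℕ) (h : j < m) :
    (sig (j+1) : B m) * tp (j+1) * (sig (j+1))⁻¹ = (tp (j+1))⁻¹ * tp j * tp (j+1) := by
  induction j with
  | zero =>
    have e := sig_tau0 h
    rw [← conj_self 0]
    simp only [zero_add]
    change _ = (_ * τ * _)⁻¹ * τ * (_ * τ * _)
    change sig 1 * (sig 1 * τ * _) * _ = _
    generalize (sig 1 : B m) = x at *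
    generalize (τ : B m) = t at *
    rw [pow_two, pow_two] at e
    have : (x * t * x⁻¹) * (x * (x * t * x⁻¹) * x⁻¹) = t * (x * t * x⁻¹) := by
      calc _ = (x * t * (x * t)) * x⁻¹ * x⁻¹ := by group
        _ = _ := by rw [e]; group
    rw [mul_assoc (x * t * x⁻¹)⁻¹ t (x * t * x⁻¹), ← this]
    group
  | succ j ih =>
    have p := ih (by omega)
    have b := sig_braid (m := m) (j := j) h
    have c := comm_low (m := m) (j := j+1) (by omega) j (by omega)
    have c2 : Commute (sig (j+1) : B m) (tp (j+1+1)) := comm_high (m := m) (j := j) 0 (by omega)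
    set x := (sig (j+1) : B m) with hx
    set y := (sig (j+1+1) : B m) with hy
    have k0 : (MulAut.conj (x * y)) (tp j) = tp (j+1) := by
      have c' : y * tp j = tp j * y := c
      rw [MulAut.conj_apply, ← conj_self j, ← hx]
      calc x * y * tp j * (x * y)⁻¹ = x * (y * tp j) * y⁻¹ * x⁻¹ := by group
        _ = _ := by rw [c']; group
    have k1 : (MulAut.conj (x * y)) (tp (j+1)) = tp (j+1+1) := by
      rw [MulAut.conj_apply]
      have c' : x * tp (j+1+1) = tp (j+1+1) * x := c2
      calc x * y * tp (j+1) * (x * y)⁻¹ = x * (y * tp (j+1) * y⁻¹) * x⁻¹ := by group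
        _ = x * tp (j+1+1) * x⁻¹ := by rw [hy, conj_self (j+1)]
        _ = _ := by rw [c']; group
    have k2 : (MulAut.conj (x * y)) x = y := by
      rw [MulAut.conj_apply, b]
      group
    have := congrArg (MulAut.conj (x * y)) p
    generalize MulAut.conj (x * y) = f at *
    simpa only [map_mul, map_inv, k0, k1, k2] using this

/-- The subgroup of looping elements. -/
def HH (m : ℕ) : Subgroup (B m) := Subgroup.closure {x : B m | ∃ i ≤ m, x = tp i}

lemma tp_mem {m i : ℕ} (h : i ≤ m) : (tp i : B m) ∈ HH m :=
  Subgroup.subset_closure ⟨i, h, rfl⟩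

lemma conj_mem_tp {m j k : ℕ} (h : j < m) (hk : k ≤ m) :
    (sig (j+1) : B m) * tp k * (sig (j+1))⁻¹ ∈ HH m := by
  rcases lt_trichotomy k j with h1 | rfl | h1
  · rw [(comm_low h k h1).eq, mul_inv_cancel_right]
    exact tp_mem hk
  · exact tp_mem (i := k+1) h
  · obtain ⟨d, rfl⟩ := Nat.exists_eq_add_of_lt h1
    rcases d with _ | d
    · rw [add_zero, conj_succ j h]
      exact mul_mem (mul_mem (inv_mem (tp_mem h)) (tp_mem h.le)) (tp_mem h)
    · have e : j + (d + 1) + 1 = j + 2 + d := by omega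
      rw [e, (comm_high d (by omega)).eq, mul_inv_cancel_right]
      exact tp_mem (by omega)

lemma conj_inv_mem_tp {m j k : ℕ} (h : j < m) (hk : k ≤ m) :
    (sig (j+1) : B m)⁻¹ * tp k * sig (j+1) ∈ HH m := by
  rcases lt_trichotomy k j with h1 | rfl | h1
  · rw [mul_assoc, ← (comm_low h k h1).eq, inv_mul_cancel_left]
    exact tp_mem hk
  · have e := conj_succ k h
    rw [← conj_self k] at e
    have : (sig (k+1) : B m)⁻¹ * tp k * sig (k+1) = tp k * tp (k+1) * (tp k)⁻¹ := by
      rw [← conj_self k]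
      generalize (sig (k+1) : B m) = x at *
      generalize (tp k : B m) = t at *
      have e' : t = (x * t * x⁻¹) * (x * (x * t * x⁻¹) * x⁻¹) * (x * t * x⁻¹)⁻¹ := by
        rw [e]
        group
      calc _ = x⁻¹ * ((x * t * x⁻¹) * (x * (x * t * x⁻¹) * x⁻¹) * (x * t * x⁻¹)⁻¹) * x := by
            rw [← e']
        _ = _ := by group
    rw [this]
    exact mul_mem (mul_mem (tp_mem h.le) (tp_mem h)) (inv_mem (tp_mem h.le))
  · obtain ⟨d, rfl⟩ := Nat.exists_eq_add_of_lt h1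
    rcases d with _ | d
    · rw [add_zero, ← conj_self j]
      have : (sig (j+1) : B m)⁻¹ * (sig (j+1) * tp j * (sig (j+1))⁻¹) * sig (j+1) = tp j := by
        group
      rw [this]
      exact tp_mem h.le
    · have e : j + (d + 1) + 1 = j + 2 + d := by omega
      rw [e, mul_assoc, ← (comm_high d (by omega)).eq, inv_mul_cancel_left]
      exact tp_mem (by omega)

lemma conj_mem_of {m : ℕ} {g : B m} (hg : ∀ k ≤ m, g * tp k * g⁻¹ ∈ HH m) {x : B m}
    (hx : x ∈ HH m) : g * x * g⁻¹ ∈ HH m := by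
  have : HH m ≤ (HH m).comap (MulAut.conj g).toMonoidHom := by
    conv_lhs => rw [HH]
    rw [Subgroup.closure_le]
    rintro _ ⟨k, hk, rfl⟩
    exact hg k hk
  exact this hx

lemma comb {m : ℕ} (g : B m) : ∃ τ' w : B m, τ' ∈ HH m ∧
    w ∈ Subgroup.closure (Set.range (σ (m := m))) ∧ g = τ' * w := by
  have hg : g ∈ Subgroup.closure (Set.range (PresentedGroup.of (rels := rels m))) := by
    rw [PresentedGroup.closure_range_of]
    trivial
  induction hg using Subgroup.closure_induction_left with
  | one => exact ⟨1, 1, one_mem _, one_mem _, by simp⟩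
  | mul_left x hx y _ ih =>
    obtain ⟨a, w, ha, hw, rfl⟩ := ih
    obtain ⟨_ | j, rfl⟩ := hx
    · exact ⟨τ * a, w, mul_mem (tp_mem (i := 0) (by omega)) ha, hw, (mul_assoc _ _ _).symm⟩
    · refine ⟨σ j * a * (σ j)⁻¹, σ j * w, conj_mem_of ?_ ha,
        mul_mem (Subgroup.subset_closure ⟨j, rfl⟩) hw, ?_⟩
      · intro k hk
        have := conj_mem_tp (m := m) j.2 hk
        rwa [sig_succ j j.2] at this
      · show σ j * (a * w) = _
        group
  | inv_mul_cancel x hx y _ ih =>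
    obtain ⟨a, w, ha, hw, rfl⟩ := ih
    obtain ⟨_ | j, rfl⟩ := hx
    · exact ⟨τ⁻¹ * a, w, mul_mem (inv_mem (tp_mem (i := 0) (by omega))) ha, hw,
        (mul_assoc _ _ _).symm⟩
    · refine ⟨(σ j)⁻¹ * a * (σ j)⁻¹⁻¹, (σ j)⁻¹ * w, conj_mem_of ?_ ha,
        mul_mem (inv_mem (Subgroup.subset_closure ⟨j, rfl⟩)) hw, ?_⟩
      · intro k hk
        have := conj_inv_mem_tp (m := m) j.2 hk
        rw [sig_succ j j.2] at this
        rwa [inv_inv]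
      · show (σ j)⁻¹ * (a * w) = _
        group

/-- **Artin combing.** Every element of `B_{1,n}` is `τ′ · w` with `τ′` in the
subgroup generated by `t′_0, …, t′_{n−1}` and `w` in the subgroup generated by the `σ_i`;
moreover the subgroup generated by `t′_0, …, t′_{n−1}` is free of rank `n`. -/
theorem artin_combing (m : ℕ) :
    (∀ g : B m, ∃ τ' w : B m,
        τ' ∈ Subgroup.closure {x : B m | ∃ i ≤ m, x = tp i} ∧
        w ∈ Subgroup.closure (Set.range (σ (m := m))) ∧ g = τ' * w) ∧
    ∃ φ : FreeGroup (Fin (m+1)) →* B m,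
      (∀ i : Fin (m+1), φ (FreeGroup.of i) = tp (i : ℕ)) ∧ Function.Injective φ ∧
      φ.range = Subgroup.closure {x : B m | ∃ i ≤ m, x = tp i} := by
  refine ⟨comb, FreeGroup.lift (fun i => tp (i : ℕ)), fun i => by simp, ?_, ?_⟩
  · have key : (rep m).comp (FreeGroup.lift (fun i : Fin (m+1) => (tp (i : ℕ) : B m))) =
        SemidirectProduct.inl.comp (FreeGroup.map (fun i : Fin (m+1) => (i : ℕ))) := by
      ext1 i
      simp [rep_tp m i (by omega)]
    have inj : Function.Injective ((rep m).comp
        (FreeGroup.lift (fun i : Fin (m+1) => (tp (i : ℕ) : B m)))) := by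
      rw [key]
      exact SemidirectProduct.inl_injective.comp (FreeGroup.map_injective Fin.val_injective)
    exact Function.Injective.of_comp (f := rep m) inj
  · rw [FreeGroup.range_lift_eq_closure]
    congr 1
    ext x
    constructor
    · rintro ⟨i, rfl⟩
      exact ⟨i, by omega, rfl⟩
    · rintro ⟨i, hi, rfl⟩
      exact ⟨⟨i, by omega⟩, rfl⟩

end MB
end
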